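/- arXiv:1410.3583 — 2 statements merged into one kernel-verified Lean document; each statement's English description precedes it below -/
import Mathlib

section
/- For each j with 1 ≤ j ≤ M such that (α_j, β_j) ≠ (0,0), the nonzero vector ψ ∈ ℂ^N with entries ψ_j = conj(α_j), ψ_{M+1+j} = −conj(β_j), and all other entries 0 (in particular the middle entry ψ_{M+1} = 0) satisfies H(d, α, β, u) · ψ = d_j · ψ. Hence each d_j, for j = 1,…,M, is an eigenvalue of H(d, α, β, u); these eigenvalues are real and independent of the parameters α, β, u. -/
open Matrix

/-- 1-based access to a vector indexed by `Fin M`: `get1 w n = w_{n}` for `1 ≤ n ≤ M`. -/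
def get1 {α : Type*} [Zero α] {M : ℕ} (w : Fin M → α) (n : ℕ) : α :=
  if h : n - 1 < M then w ⟨n - 1, h⟩ else 0

/-- The arrowhead-type matrix `H(d, α, β, u)` of size `N = 2M+1`, with `d ∈ ℝ^M`,
`α, β ∈ ℂ^M`, `u ∈ ℝ` (entries described with 1-based indices `a = i+1`, `b = j+1`). -/
def Hmat (M : ℕ) (d : Fin M → ℝ) (α β : Fin M → ℂ) (u : ℝ) :
    Matrix (Fin (2 * M + 1)) (Fin (2 * M + 1)) ℂ :=
  Matrix.of fun i j =>
    if (i : ℕ) + 1 ≤ M ∧ (j : ℕ) = (i : ℕ) then (get1 d ((i : ℕ) + 1) : ℝ)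
    else if M + 2 ≤ (i : ℕ) + 1 ∧ (j : ℕ) = (i : ℕ) then (get1 d ((i : ℕ) + 1 - (M + 1)) : ℝ)
    else if (i : ℕ) + 1 = M + 1 ∧ (j : ℕ) + 1 = M + 1 then (u : ℂ)
    else if (i : ℕ) + 1 ≤ M ∧ (j : ℕ) + 1 = M + 1 then get1 α ((i : ℕ) + 1)
    else if (i : ℕ) + 1 = M + 1 ∧ (j : ℕ) + 1 ≤ M then star (get1 β ((j : ℕ) + 1))
    else if (i : ℕ) + 1 = M + 1 ∧ M + 2 ≤ (j : ℕ) + 1 then star (get1 α ((j : ℕ) + 1 - (M + 1)))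
    else if M + 2 ≤ (i : ℕ) + 1 ∧ (j : ℕ) + 1 = M + 1 then get1 β ((i : ℕ) + 1 - (M + 1))
    else 0

/-- A 1-based access at a valid position returns the corresponding entry. -/
theorem get1_succ {α : Type*} [Zero α] {M : ℕ} (w : Fin M → α) (j : Fin M) :
    get1 w ((j : ℕ) + 1) = w j := by
  simp [get1]

/-- The product of a matrix with a vector supported on two distinct positions. -/
theorem mulVec_ite_ite_apply {R : Type*} [NonUnitalNonAssocSemiring R] {m : Type*} {n : ℕ}
    (A : Matrix m (Fin n) R) (a b : Fin n) (hab : a ≠ b) (x y : R) (i : m) :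
    (A *ᵥ fun k => if (k : ℕ) = (a : ℕ) then x else if (k : ℕ) = (b : ℕ) then y else 0) i
      = A i a * x + A i b * y := by
  rw [Matrix.mulVec, dotProduct, Finset.sum_eq_add a b hab]
  · simp [Fin.val_inj, hab.symm]
  · rintro c - ⟨hca, hcb⟩
    simp [Fin.val_inj, hca, hcb]
  · simp
  · simp

/-- for each `j` with `(α_j, β_j) ≠ (0,0)`, the nonzero vector `ψ`
with `ψ_j = conj α_j`, `ψ_{M+1+j} = -conj β_j` (1-based positions, zero middle
entry) satisfies `H ψ = d_j ψ`; hence each `d_j` is a (real, parameter-independent)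
eigenvalue of `H(d, α, β, u)`. -/
theorem statement6 (M : ℕ) (hM : 1 ≤ M) (d : Fin M → ℝ) (α β : Fin M → ℂ) (u : ℝ)
    (j : Fin M) (hj : ¬(α j = 0 ∧ β j = 0)) :
    (fun i : Fin (2 * M + 1) =>
        if (i : ℕ) = (j : ℕ) then star (α j)
        else if (i : ℕ) = M + 1 + (j : ℕ) then -star (β j) else 0) ≠ 0 ∧
    (Hmat M d α β u).mulVec
        (fun i : Fin (2 * M + 1) =>
          if (i : ℕ) = (j : ℕ) then star (α j)
          else if (i : ℕ) = M + 1 + (j : ℕ) then -star (β j) else 0)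
      = ((d j : ℂ)) •
        (fun i : Fin (2 * M + 1) =>
          if (i : ℕ) = (j : ℕ) then star (α j)
          else if (i : ℕ) = M + 1 + (j : ℕ) then -star (β j) else 0) := by
  have hjM := j.isLt
  obtain ⟨a, ha⟩ : ∃ a : Fin (2 * M + 1), (a : ℕ) = j := ⟨⟨j, by omega⟩, rfl⟩
  obtain ⟨b, hb⟩ : ∃ b : Fin (2 * M + 1), (b : ℕ) = M + 1 + j := ⟨⟨M + 1 + j, by omega⟩, rfl⟩
  have hab : a ≠ b := by rw [Ne, Fin.ext_iff]; omega
  have hsub : M + 1 + (j : ℕ) + 1 - (M + 1) = j + 1 := by omega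
  refine ⟨fun h => hj ⟨?_, ?_⟩, ?_⟩
  · simpa [ha] using congrFun h a
  · simpa [hb] using congrFun h b
  · rw [← hb, ← ha]
    ext i
    rw [mulVec_ite_ite_apply _ a b hab]
    simp only [Hmat, Matrix.of_apply, Pi.smul_apply, smul_eq_mul, ha, hb]
    rcases lt_trichotomy (i : ℕ) M with hi | hi | hi
    · have h₁ : (i : ℕ) ≠ M + 1 + j := by omega
      by_cases hij : (i : ℕ) = j
      · simp [hij, get1_succ, show (j : ℕ) + 1 ≤ M by omega, show ¬ M + 2 ≤ (j : ℕ) + 1 by omega,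
          show (j : ℕ) ≠ M by omega,
          show M + 1 + (j : ℕ) ≠ M by omega]
      · simp [hij, h₁, h₁.symm, Ne.symm hij, show ¬ M + 2 ≤ (i : ℕ) + 1 by omega,
          show (i : ℕ) ≠ M by omega, show (j : ℕ) ≠ M by omega,
          show M + 1 + (j : ℕ) ≠ M by omega]
    · simp [hi, hsub, get1_succ, show (j : ℕ) ≠ M by omega, show M ≠ (j : ℕ) by omega,
        show (j : ℕ) + 1 ≤ M by omega, show M + 1 + (j : ℕ) ≠ M by omega,
        show M ≠ M + 1 + (j : ℕ) by omega, show ¬ M + 1 + (j : ℕ) + 1 ≤ M by omega,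
        show M + 2 ≤ M + 1 + (j : ℕ) + 1 by omega]
      ring
    · have h₁ : (i : ℕ) ≠ j := by omega
      by_cases hij : (i : ℕ) = M + 1 + j
      · simp [hij, hsub, get1_succ, show ¬ M + 1 + (j : ℕ) + 1 ≤ M by omega,
          show M + 2 ≤ M + 1 + (j : ℕ) + 1 by omega, show (j : ℕ) ≠ M by omega,
          show M + 1 + (j : ℕ) ≠ M by omega]
      · simp [hij, h₁, h₁.symm, Ne.symm hij, show (i : ℕ) ≠ M by omega,
          show (j : ℕ) ≠ M by omega, show M + 1 + (j : ℕ) ≠ M by omega]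
end

section
/- Conversely, suppose ψ ∈ ℂ^N satisfies H(d, α, β, u) · ψ = ε · ψ with ε ≠ d_i for all i = 1,…,M and with nonzero middle component ψ_{M+1} ≠ 0. Then ε satisfies the secular equation ε = u + Σ_{i=1}^{M} (conj(β_i)·α_i + conj(α_i)·β_i)/(ε − d_i), and ψ is proportional to the vector with entries α_i/(ε − d_i) (positions 1..M), 1 (position M+1), and β_i/(ε − d_i) (positions M+2..N). -/
open Matrix

/-- The reference vector with entries `α_i/(ε - d_i)` (positions `1..M`),
`1` (position `M+1`), `β_i/(ε - d_i)` (positions `M+2..2M+1`). -/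
noncomputable def psiVec (M : ℕ) (d : Fin M → ℝ) (α β : Fin M → ℂ) (ε : ℂ) :
    Fin (2 * M + 1) → ℂ :=
  fun i =>
    if h : (i : ℕ) < M then α ⟨(i : ℕ), h⟩ / (ε - (d ⟨(i : ℕ), h⟩ : ℂ))
    else if h' : M + 1 ≤ (i : ℕ) then
      β ⟨(i : ℕ) - (M + 1), by have := i.isLt; omega⟩ /
        (ε - (d ⟨(i : ℕ) - (M + 1), by have := i.isLt; omega⟩ : ℂ))
    else 1

/-- Splitting a sum over `2M+1` indices into the first block, the middle index and the last block. -/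
theorem sum_fin_two_mul_add_one {A : Type*} [AddCommMonoid A] (M : ℕ) (f : Fin (2 * M + 1) → A) :
    ∑ j, f j = ∑ i : Fin M, f ⟨i, by omega⟩ + f ⟨M, by omega⟩ +
      ∑ i : Fin M, f ⟨M + 1 + i, by omega⟩ := by
  have h : M + 1 + M = 2 * M + 1 := by omega
  rw [← (finCongr h).sum_comp f, Fin.sum_univ_add, Fin.sum_univ_castSucc]
  rfl

theorem Hmat_mulVec_first (M : ℕ) (d : Fin M → ℝ) (α β : Fin M → ℂ) (u : ℝ)
    (ψ : Fin (2 * M + 1) → ℂ) (i : Fin M) :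
    (Hmat M d α β u).mulVec ψ ⟨i, by omega⟩ =
      d i * ψ ⟨i, by omega⟩ + α i * ψ ⟨M, by omega⟩ := by
  have hi := i.isLt
  rw [mulVec, dotProduct, sum_fin_two_mul_add_one, Finset.sum_eq_single i,
    Finset.sum_eq_zero]
  · simp [Hmat, get1, hi.ne, hi.ne', hi]
  · intro j _
    have hj := j.isLt
    simp only [Hmat, of_apply, mul_eq_zero]
    left
    split_ifs <;> first | rfl | omega
  · intro j _ hji
    have hj := j.isLt
    have hne : (j : ℕ) ≠ i := fun h => hji (Fin.ext h)
    simp only [Hmat, of_apply, mul_eq_zero]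
    left
    split_ifs <;> first | rfl | omega
  · simp

theorem Hmat_mulVec_last (M : ℕ) (d : Fin M → ℝ) (α β : Fin M → ℂ) (u : ℝ)
    (ψ : Fin (2 * M + 1) → ℂ) (i : Fin M) :
    (Hmat M d α β u).mulVec ψ ⟨M + 1 + i, by omega⟩ =
      d i * ψ ⟨M + 1 + i, by omega⟩ + β i * ψ ⟨M, by omega⟩ := by
  have hi := i.isLt
  have hsub : M + 1 + (i : ℕ) + 1 - (M + 1) - 1 = i := by omega
  rw [mulVec, dotProduct, sum_fin_two_mul_add_one, Finset.sum_eq_zero,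
    Finset.sum_eq_single i]
  · have h₁ : Hmat M d α β u ⟨M + 1 + i, by omega⟩ ⟨M, by omega⟩ = β i := by
      simp only [Hmat, of_apply, get1, and_true, hsub]
      split_ifs <;> first | rfl | omega
    have h₂ : Hmat M d α β u ⟨M + 1 + i, by omega⟩ ⟨M + 1 + i, by omega⟩ = d i := by
      simp only [Hmat, of_apply, get1, and_true, hsub]
      split_ifs <;> first | rfl | omega
    rw [h₁, h₂]
    ring
  · intro j _ hji
    have hj := j.isLt
    have hne : (j : ℕ) ≠ i := fun h => hji (Fin.ext h)
    simp only [Hmat, of_apply, mul_eq_zero]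
    left
    split_ifs <;> first | rfl | omega
  · simp
  · intro j _
    have hj := j.isLt
    simp only [Hmat, of_apply, mul_eq_zero]
    left
    split_ifs <;> first | rfl | omega

theorem Hmat_mulVec_middle (M : ℕ) (d : Fin M → ℝ) (α β : Fin M → ℂ) (u : ℝ)
    (ψ : Fin (2 * M + 1) → ℂ) :
    (Hmat M d α β u).mulVec ψ ⟨M, by omega⟩ =
      ∑ i : Fin M, star (β i) * ψ ⟨i, by omega⟩ + u * ψ ⟨M, by omega⟩ +
        ∑ i : Fin M, star (α i) * ψ ⟨M + 1 + i, by omega⟩ := by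
  rw [mulVec, dotProduct, sum_fin_two_mul_add_one]
  congr 1
  · congr 1
    · refine Finset.sum_congr rfl fun j _ => ?_
      have hj := j.isLt
      congr 1
      simp only [Hmat, of_apply, get1, true_and, Nat.add_sub_cancel]
      split_ifs <;> first | rfl | omega
    · congr 1
      simp only [Hmat, of_apply, and_true, true_and]
      split_ifs <;> first | rfl | omega
  · refine Finset.sum_congr rfl fun j _ => ?_
    have hj := j.isLt
    have hsub : M + 1 + (j : ℕ) + 1 - (M + 1) - 1 = j := by omega
    congr 1
    simp only [Hmat, of_apply, get1, true_and, hsub]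
    split_ifs <;> first | rfl | omega

/-- converse: if `H ψ = ε ψ` with `ε ≠ d_i` for all `i` and the
middle component `ψ_{M+1} ≠ 0`, then `ε` solves the secular equation
`ε = u + Σ_i (conj β_i · α_i + conj α_i · β_i)/(ε - d_i)` and `ψ` is
proportional to the reference vector. -/
theorem statement8 (M : ℕ) (hM : 1 ≤ M) (d : Fin M → ℝ) (α β : Fin M → ℂ) (u : ℝ)
    (ε : ℂ) (hεd : ∀ i : Fin M, ε ≠ (d i : ℂ))
    (ψ : Fin (2 * M + 1) → ℂ)
    (heig : (Hmat M d α β u).mulVec ψ = ε • ψ)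
    (hmid : ψ ⟨M, by omega⟩ ≠ 0) :
    ε = (u : ℂ) + ∑ i : Fin M,
      (star (β i) * α i + star (α i) * β i) / (ε - (d i : ℂ)) ∧
    ∃ c : ℂ, c ≠ 0 ∧ ψ = c • psiVec M d α β ε := by
  have hne (i : Fin M) : ε - d i ≠ 0 := sub_ne_zero.mpr (hεd i)
  have hfirst (i : Fin M) :
      ψ ⟨i, by omega⟩ = ψ ⟨M, by omega⟩ * (α i / (ε - d i)) := by
    have h := congrFun heig ⟨i, by omega⟩
    rw [Hmat_mulVec_first, Pi.smul_apply, smul_eq_mul] at h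
    rw [mul_div_assoc', eq_div_iff (hne i)]
    linear_combination -h
  have hlast (i : Fin M) :
      ψ ⟨M + 1 + i, by omega⟩ = ψ ⟨M, by omega⟩ * (β i / (ε - d i)) := by
    have h := congrFun heig ⟨M + 1 + i, by omega⟩
    rw [Hmat_mulVec_last, Pi.smul_apply, smul_eq_mul] at h
    rw [mul_div_assoc', eq_div_iff (hne i)]
    linear_combination -h
  refine ⟨?_, ψ ⟨M, by omega⟩, hmid, ?_⟩
  · have h := congrFun heig ⟨M, by omega⟩
    rw [Hmat_mulVec_middle, Pi.smul_apply, smul_eq_mul] at h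
    apply mul_right_cancel₀ hmid
    rw [← h, add_mul, add_right_comm, ← Finset.sum_add_distrib, Finset.sum_mul, add_comm]
    congr 1
    refine Finset.sum_congr rfl fun i _ => ?_
    rw [hfirst, hlast]
    ring
  · funext ⟨k, hk⟩
    rw [Pi.smul_apply, smul_eq_mul, psiVec]
    dsimp only
    split_ifs with h₁ h₂
    · exact hfirst ⟨k, h₁⟩
    · obtain ⟨i, rfl⟩ := Nat.exists_eq_add_of_le h₂
      simpa using hlast ⟨i, by omega⟩
    · obtain rfl : k = M := by omega
      rw [mul_one]
end
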